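/- Description of the stabilizer intersection: In the local setup, the intersection Δ K_d Δ^{-1} ∩ K_d equals { g ∈ K_d : every entry g_{ij} of g with i ≤ r < j lies in t^{d+1}·O }; that is, an element g ∈ GL_n(O) with g ≡ I_n (mod t^d) lies in Δ K_d Δ^{-1} if and only if the upper-right r×(n−r) block of g − I_n has all entries divisible by t^{d+1}. -/

import Mathlib

/-!
Local setup: `O = k⟦t⟧` is `PowerSeries k`, `F = k((t))` is `LaurentSeries k`.
`Delta` is the diagonal matrix with first `r` entries `t` and remaining entries `1`
(`DeltaInv` is its inverse); `Kd` is the principal congruence subgroup of level `d`.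
Statement: `Δ K_d Δ⁻¹ ∩ K_d` consists exactly of the `g ∈ K_d` whose upper-right
`r × (n-r)` block of `g - 1` has all entries divisible by `t^(d+1)`.
-/

noncomputable section

/-- The canonical inclusion `k⟦t⟧ →+* k((t))`. -/
def toF (k : Type) [Field k] : PowerSeries k →+* LaurentSeries k :=
  HahnSeries.ofPowerSeries ℤ k

/-- The diagonal matrix `Δ = diag(t,…,t,1,…,1)` with `r` entries equal to `t`. -/
def Delta (k : Type) [Field k] (n r : ℕ) :
    Matrix (Fin n) (Fin n) (LaurentSeries k) :=
  Matrix.diagonal (fun i => if (i : ℕ) < r then toF k PowerSeries.X else 1)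

/-- The inverse `Δ⁻¹ = diag(t⁻¹,…,t⁻¹,1,…,1)` of `Delta`. -/
def DeltaInv (k : Type) [Field k] (n r : ℕ) :
    Matrix (Fin n) (Fin n) (LaurentSeries k) :=
  Matrix.diagonal (fun i => if (i : ℕ) < r then (toF k PowerSeries.X)⁻¹ else 1)

/-- The principal congruence subgroup `K_d ⊆ GL_n(O)`, viewed as the set of
matrices over `F = k((t))` that come from a matrix over `O = k⟦t⟧` which is
invertible over `O` and congruent to the identity modulo `t^d`. -/
def Kd (k : Type) [Field k] (n d : ℕ) :
    Set (Matrix (Fin n) (Fin n) (LaurentSeries k)) :=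
  { g | ∃ h : Matrix (Fin n) (Fin n) (PowerSeries k),
      (∀ i j, g i j = toF k (h i j)) ∧ IsUnit h.det ∧
      ∀ i j, (PowerSeries.X : PowerSeries k) ^ d ∣ (h - 1) i j }

theorem toF_injective (k : Type) [Field k] : Function.Injective (toF k) :=
  HahnSeries.ofPowerSeries_injective

theorem toF_X_ne_zero (k : Type) [Field k] : toF k PowerSeries.X ≠ 0 :=
  (map_ne_zero_iff _ (toF_injective k)).2 PowerSeries.X_ne_zero

theorem Delta_mul_DeltaInv (k : Type) [Field k] (n r : ℕ) :
    Delta k n r * DeltaInv k n r = 1 := by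
  rw [Delta, DeltaInv, Matrix.diagonal_mul_diagonal, ← Matrix.diagonal_one]
  congr 1
  funext i
  split_ifs <;> simp [toF_X_ne_zero]

theorem Delta_conj_apply (k : Type) [Field k] (n r : ℕ)
    (g : Matrix (Fin n) (Fin n) (LaurentSeries k)) (i j : Fin n) :
    (Delta k n r * g * DeltaInv k n r) i j =
      (if (i : ℕ) < r then toF k PowerSeries.X else 1) * g i j *
        (if (j : ℕ) < r then (toF k PowerSeries.X)⁻¹ else 1) := by
  rw [DeltaInv, Matrix.mul_diagonal, Delta, Matrix.diagonal_mul]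

theorem det_Delta_conj (k : Type) [Field k] (n r : ℕ)
    (g : Matrix (Fin n) (Fin n) (LaurentSeries k)) :
    (Delta k n r * g * DeltaInv k n r).det = g.det := by
  have h := congrArg Matrix.det (Delta_mul_DeltaInv k n r)
  rw [Matrix.det_mul, Matrix.det_one] at h
  rw [Matrix.det_mul, Matrix.det_mul, mul_right_comm, h, one_mul]

/-- Description of the stabilizer intersection `Δ K_d Δ⁻¹ ∩ K_d`: it consists of
the `g ∈ K_d` all of whose upper-right entries `(g - 1) i j` (`i ≤ r < j`) lie in
`t^(d+1)·O`. -/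
theorem stabilizer_intersection
    (k : Type) [Field k] (n r d : ℕ) (hn : 1 ≤ n) (hr : r ≤ n) (hd : 1 ≤ d) :
    { x | ∃ g ∈ Kd k n d, x = Delta k n r * g * DeltaInv k n r } ∩ Kd k n d
      = { g : Matrix (Fin n) (Fin n) (LaurentSeries k) |
          g ∈ Kd k n d ∧
          ∀ i j : Fin n, (i : ℕ) < r → r ≤ (j : ℕ) →
            ∃ y : PowerSeries k,
              (g - 1) i j = toF k ((PowerSeries.X : PowerSeries k) ^ (d + 1) * y) } := by
  have hne : ∀ i j : Fin n, (i : ℕ) < r → r ≤ (j : ℕ) → i ≠ j := by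
    rintro i j hi hj rfl
    omega
  have hX := toF_X_ne_zero k
  ext x
  constructor
  · rintro ⟨⟨g, ⟨h, hg, -, hd'⟩, rfl⟩, hx⟩
    refine ⟨hx, fun i j hi hj => ?_⟩
    obtain ⟨y, hy⟩ := hd' i j
    rw [Matrix.sub_apply, Matrix.one_apply_ne (hne i j hi hj), sub_zero] at hy
    refine ⟨y, ?_⟩
    rw [Matrix.sub_apply, Matrix.one_apply_ne (hne i j hi hj), sub_zero, Delta_conj_apply,
      if_pos hi, if_neg hj.not_gt, mul_one, hg, hy, ← map_mul, pow_succ']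
    congr 1
    ring
  · rintro ⟨hx, hy⟩
    refine ⟨?_, hx⟩
    obtain ⟨h, hxh, hdet, hd'⟩ := hx
    choose! y hy using hy
    let h' : Matrix (Fin n) (Fin n) (PowerSeries k) := fun i j =>
      if (i : ℕ) < r then if (j : ℕ) < r then h i j else PowerSeries.X ^ d * y i j
      else if (j : ℕ) < r then PowerSeries.X * h i j else h i j
    have hconj : x = Delta k n r * h'.map (toF k) * DeltaInv k n r := by
      ext1 i j
      rw [Delta_conj_apply, Matrix.map_apply]
      by_cases hi : (i : ℕ) < r <;> by_cases hj : (j : ℕ) < r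
      · simp only [h', if_pos hi, if_pos hj, hxh]
        field_simp
      · have hij := hy i j hi (not_lt.1 hj)
        rw [Matrix.sub_apply, Matrix.one_apply_ne (hne i j hi (not_lt.1 hj)), sub_zero] at hij
        simp only [h', if_pos hi, if_neg hj, hij, map_mul, map_pow]
        ring
      · simp only [h', if_neg hi, if_pos hj, hxh, map_mul]
        field_simp
      · simp only [h', if_neg hi, if_neg hj, hxh, one_mul, mul_one]
    refine ⟨h'.map (toF k), ⟨h', fun _ _ => rfl, ?_, fun i j => ?_⟩, hconj⟩
    · have hxm : x = h.map (toF k) := Matrix.ext hxh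
      have hdet' : h'.det = h.det := by
        apply toF_injective k
        rw [RingHom.map_det, RingHom.map_det, RingHom.mapMatrix_apply, RingHom.mapMatrix_apply,
          ← hxm, hconj, det_Delta_conj]
      rwa [hdet']
    · have hij := hd' i j
      rw [Matrix.sub_apply] at hij ⊢
      by_cases hi : (i : ℕ) < r <;> by_cases hj : (j : ℕ) < r
      · simpa only [h', if_pos hi, if_pos hj] using hij
      · simp only [h', if_pos hi, if_neg hj]
        rw [Matrix.one_apply_ne (hne i j hi (not_lt.1 hj)), sub_zero]
        exact dvd_mul_right _ _
      · rw [Matrix.one_apply_ne (hne j i hj (not_lt.1 hi)).symm, sub_zero] at hij ⊢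
        simp only [h', if_neg hi, if_pos hj]
        exact hij.mul_left _
      · simpa only [h', if_neg hi, if_neg hj] using hij
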